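/- Let A ≥ 1 and let (X,d) be an A-uniform metric space with d(x) > 0 for every x ∈ X, and let k be its quasihyperbolic metric. Then there exists δ ≥ 0 depending only on A such that (X,k) is δ-hyperbolic, i.e. (x|y)^k_w ≥ min((x|z)^k_w, (z|y)^k_w) − δ for all x, y, z, w ∈ X. -/

import Mathlib

open Metric Filter Set

noncomputable section

universe u v

/-- Gromov product of `x` and `y` with respect to base point `w`,
for a real-valued distance kernel `ρ`. -/
def gromovProd {X : Type u} (ρ : X → X → ℝ) (w x y : X) : ℝ :=
  (ρ x w + ρ y w - ρ x y) / 2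

/-- `(X, ρ)` is δ-hyperbolic. -/
def IsDeltaHyp {X : Type u} (ρ : X → X → ℝ) (δ : ℝ) : Prop :=
  ∀ x y z w : X, gromovProd ρ w x y ≥ min (gromovProd ρ w x z) (gromovProd ρ w z y) - δ

/-- `f` is a (λ,μ)-rough similarity. -/
def RoughSimilarity {X : Type u} {Y : Type v} [MetricSpace X] [MetricSpace Y]
    (lam mu : ℝ) (f : X → Y) : Prop :=
  (∀ y : Y, ∃ x : X, dist y (f x) ≤ mu) ∧
  (∀ x x' : X, lam * dist x x' - mu ≤ dist (f x) (f x') ∧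
    dist (f x) (f x') ≤ lam * dist x x' + mu)

/-- The distance from `x ∈ X` to the metric boundary `∂X = X̄ \ X`. -/
def distToBdry (X : Type u) [MetricSpace X] (x : X) : ℝ :=
  Metric.infDist (x : UniformSpace.Completion X)
    (Set.range ((↑) : X → UniformSpace.Completion X))ᶜ

/-- `X` is noncomplete, i.e. `∂X = X̄ \ X ≠ ∅`. -/
def IsNoncomplete (X : Type u) [MetricSpace X] : Prop :=
  ((Set.range ((↑) : X → UniformSpace.Completion X))ᶜ).Nonempty

/-- Ibragimov's hyperbolization metric. -/
def hMetric (X : Type u) [MetricSpace X] (x y : X) : ℝ :=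
  2 * Real.log ((dist x y + max (distToBdry X x) (distToBdry X y)) /
    Real.sqrt (distToBdry X x * distToBdry X y))

/-- The j̃-metric. -/
def jtMetric (X : Type u) [MetricSpace X] (x y : X) : ℝ :=
  (1 / 2) * Real.log ((1 + dist x y / distToBdry X x) * (1 + dist x y / distToBdry X y))

/-- The quasihyperbolic metric. -/
def quasihyperbolic (X : Type u) [MetricSpace X] (x y : X) : ℝ :=
  sInf {r : ℝ | ∃ L : ℝ, 0 ≤ L ∧ ∃ γ : ℝ → X,
    LipschitzOnWith 1 γ (Set.Icc 0 L) ∧ γ 0 = x ∧ γ L = y ∧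
    r = ∫ t in (0:ℝ)..L, (distToBdry X (γ t))⁻¹}

/-- `X` is an `A`-uniform metric space. -/
def IsUniformMS (X : Type u) [MetricSpace X] (A : ℝ) : Prop :=
  ∀ x y : X, ∃ L : ℝ, 0 ≤ L ∧ ∃ γ : ℝ → X,
    LipschitzOnWith 1 γ (Set.Icc 0 L) ∧ γ 0 = x ∧ γ L = y ∧
    L ≤ A * dist x y ∧ ∀ t ∈ Set.Icc (0:ℝ) L, min t (L - t) ≤ A * distToBdry X (γ t)

/-- `X` is unbounded. -/
def IsUnbounded (X : Type u) [MetricSpace X] : Prop :=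
  ¬ Bornology.IsBounded (Set.univ : Set X)

section Auxiliary

variable {X : Type u} [MetricSpace X]

theorem distToBdry_le_add_dist (x y : X) :
    distToBdry X x ≤ distToBdry X y + dist x y := by
  unfold distToBdry
  rw [← UniformSpace.Completion.dist_eq]
  exact Metric.infDist_le_infDist_add_dist

/-- The quantity `|x - y| + d(x) + d(y)`; it is symmetric and satisfies the triangle inequality. -/
def bdrySum (x y : X) : ℝ := dist x y + distToBdry X x + distToBdry X y

theorem bdrySum_comm (x y : X) : bdrySum x y = bdrySum y x := by
  unfold bdrySum; rw [dist_comm]; ring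

theorem distToBdry_nonneg (x : X) : 0 ≤ distToBdry X x := Metric.infDist_nonneg

theorem bdrySum_nonneg (x y : X) : 0 ≤ bdrySum x y := by
  have := distToBdry_nonneg x
  have := distToBdry_nonneg y
  unfold bdrySum; positivity

theorem bdrySum_triangle (x y z : X) : bdrySum x z ≤ bdrySum x y + bdrySum y z := by
  have := distToBdry_nonneg y
  have := dist_triangle x y z
  unfold bdrySum; linarith

theorem bdrySum_pos (hd : ∀ x : X, 0 < distToBdry X x) (x y : X) : 0 < bdrySum x y := by
  have := hd x
  have := hd y
  have := dist_nonneg (x := x) (y := y)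
  unfold bdrySum; linarith

/-- The multiplicative four point condition for `bdrySum`. -/
theorem bdrySum_mul_le_max (x y z w : X) :
    bdrySum x y * bdrySum z w ≤
      4 * max (bdrySum x z * bdrySum y w) (bdrySum x w * bdrySum z y) := by
  have t1 := bdrySum_triangle x z y
  have t2 := bdrySum_triangle x w y
  have t3 := bdrySum_triangle z x w
  have t4 := bdrySum_triangle z y w
  rw [bdrySum_comm w y] at t2
  rw [bdrySum_comm z x] at t3
  have n1 := bdrySum_nonneg x z
  have n2 := bdrySum_nonneg y w
  have n3 := bdrySum_nonneg x w
  have n4 := bdrySum_nonneg z y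
  have n5 := bdrySum_nonneg x y
  have n6 := bdrySum_nonneg z w
  generalize bdrySum x z = a at *
  generalize bdrySum y w = b at *
  generalize bdrySum x w = c at *
  generalize bdrySum z y = e at *
  generalize bdrySum x y = p at *
  generalize bdrySum z w = q at *
  have key : ∀ u v : ℝ, 0 ≤ u → 0 ≤ v → p ≤ 2 * u → q ≤ 2 * v → p * q ≤ 4 * (u * v) := by
    intro u v hu hv h1 h2
    calc p * q ≤ (2 * u) * (2 * v) := mul_le_mul h1 h2 n6 (by linarith)
      _ = 4 * (u * v) := by ring
  have l1 : a * b ≤ max (a * b) (c * e) := le_max_left _ _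
  have l2 : c * e ≤ max (a * b) (c * e) := le_max_right _ _
  rcases le_total a e with h1 | h1
  · rcases le_total a c with h2 | h2
    · nlinarith [key e c n4 n3 (by linarith) (by linarith)]
    · rcases le_total b c with h3 | h3
      · nlinarith [key c e n3 n4 (by linarith) (by linarith)]
      · nlinarith [key b a n2 n1 (by linarith) (by linarith)]
  · rcases le_total e b with h2 | h2
    · nlinarith [key a b n1 n2 (by linarith) (by linarith)]
    · rcases le_total b c with h3 | h3
      · nlinarith [key c e n3 n4 (by linarith) (by linarith)]
      · nlinarith [key b a n2 n1 (by linarith) (by linarith)]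

/-- `p` lies within multiplicative error `C` between `x` and `y`. -/
def BdryBetween (C : ℝ) (x y p : X) : Prop :=
  bdrySum x p * bdrySum p y ≤ C * (bdrySum x y * distToBdry X p)

theorem BdryBetween.symm {C : ℝ} {x y p : X} (h : BdryBetween C x y p) :
    BdryBetween C y x p := by
  unfold BdryBetween at *
  rw [bdrySum_comm y p, bdrySum_comm p x, bdrySum_comm y x, mul_comm]
  exact h

theorem BdryBetween.mono {C C' : ℝ} {x y p : X} (h : BdryBetween C x y p) (hC : C ≤ C') :
    BdryBetween C' x y p :=
  le_trans h (mul_le_mul_of_nonneg_right hC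
    (mul_nonneg (bdrySum_nonneg _ _) (distToBdry_nonneg _)))

theorem BdryBetween.or (hd : ∀ x : X, 0 < distToBdry X x) {C : ℝ} (hC : 0 ≤ C) {x y p : X}
    (h : BdryBetween C x y p) (z : X) :
    BdryBetween (4 * C) x z p ∨ BdryBetween (4 * C) z y p := by
  unfold BdryBetween at *
  have h4 := bdrySum_mul_le_max x y p z
  have px := bdrySum_pos hd x p
  have py := bdrySum_pos hd p y
  have pz := bdrySum_pos hd p z
  have hp := hd p
  rw [bdrySum_comm z p, bdrySum_comm z y]
  rw [max_def] at h4
  have h5 := mul_le_mul_of_nonneg_right h pz.le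
  split_ifs at h4
  · left
    refine le_of_mul_le_mul_right ?_ py
    nlinarith [mul_le_mul_of_nonneg_left h4 (mul_nonneg hC hp.le)]
  · right
    refine le_of_mul_le_mul_right ?_ px
    nlinarith [mul_le_mul_of_nonneg_left h4 (mul_nonneg hC hp.le)]

/-- A continuous function reaches a level for a first time. -/
theorem exists_first_hit {f : ℝ → ℝ} {a b c : ℝ} (hab : a ≤ b) (hf : ContinuousOn f (Icc a b))
    (ha : f a ≤ c) (hb : c ≤ f b) :
    ∃ s ∈ Icc a b, f s = c ∧ ∀ r ∈ Icc a s, f r ≤ c := by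
  have hne : (Icc a b ∩ f ⁻¹' {c}).Nonempty := by
    obtain ⟨s, hs, h⟩ := intermediate_value_Icc hab hf ⟨ha, hb⟩
    exact ⟨s, hs, h⟩
  have hcp : IsCompact (Icc a b ∩ f ⁻¹' {c}) :=
    isCompact_Icc.of_isClosed_subset (hf.preimage_isClosed_of_isClosed isClosed_Icc
      isClosed_singleton) inter_subset_left
  obtain ⟨s, hs, hmin⟩ := hcp.exists_isLeast hne
  refine ⟨s, hs.1, hs.2, fun r hr => ?_⟩
  by_contra! hlt
  have hrb : r ≤ b := hr.2.trans hs.1.2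
  obtain ⟨q, hq, hqc⟩ := intermediate_value_Icc hr.1
    (hf.mono (Icc_subset_Icc_right hrb)) ⟨ha, hlt.le⟩
  have h1 : s ≤ q := hmin ⟨⟨hq.1, hq.2.trans hrb⟩, hqc⟩
  have : q = r := le_antisymm hq.2 (hr.2.trans h1)
  rw [this] at hqc
  exact hlt.ne' hqc

/-- A `1`-Lipschitz curve defined on `[0, L]`. -/
def IsCurve (γ : ℝ → X) (L : ℝ) : Prop := 0 ≤ L ∧ LipschitzOnWith 1 γ (Icc 0 L)

theorem IsCurve.dist_le {γ : ℝ → X} {L : ℝ} (h : IsCurve γ L) {a b : ℝ}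
    (ha : 0 ≤ a) (hab : a ≤ b) (hb : b ≤ L) : dist (γ a) (γ b) ≤ b - a := by
  have := h.2.dist_le_mul a ⟨ha, hab.trans hb⟩ b ⟨ha.trans hab, hb⟩
  rw [dist_comm a b, Real.dist_eq, abs_of_nonneg (by linarith)] at this
  simpa using this

theorem isCurve_of_dist_le {γ : ℝ → X} {L : ℝ} (hL : 0 ≤ L)
    (h : ∀ a b, 0 ≤ a → a ≤ b → b ≤ L → dist (γ a) (γ b) ≤ b - a) : IsCurve γ L := by
  refine ⟨hL, LipschitzOnWith.of_dist_le_mul fun a ha b hb => ?_⟩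
  rw [Real.dist_eq]
  rcases le_total a b with hab | hab
  · rw [abs_sub_comm, abs_of_nonneg (by linarith)]
    simpa using h a b ha.1 hab hb.2
  · rw [abs_of_nonneg (by linarith), dist_comm]
    simpa using h b a hb.1 hab ha.2

theorem IsCurve.continuousOn {γ : ℝ → X} {L : ℝ} (h : IsCurve γ L) :
    ContinuousOn γ (Icc 0 L) := h.2.continuousOn

theorem continuous_distToBdry : Continuous (distToBdry X) := by
  unfold distToBdry
  exact (Metric.continuous_infDist_pt _).comp (UniformSpace.Completion.continuous_coe X)

theorem continuous_bdrySum : Continuous fun p : X × X => bdrySum p.1 p.2 := by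
  unfold bdrySum
  have := continuous_distToBdry (X := X)
  fun_prop

/-- The quasihyperbolic density along a curve. -/
def qhDensity (γ : ℝ → X) (t : ℝ) : ℝ := (distToBdry X (γ t))⁻¹

theorem qhDensity_nonneg (γ : ℝ → X) (t : ℝ) : 0 ≤ qhDensity γ t :=
  inv_nonneg.2 (distToBdry_nonneg _)

theorem IsCurve.distToBdry_continuousOn {γ : ℝ → X} {L : ℝ} (h : IsCurve γ L) :
    ContinuousOn (fun t => distToBdry X (γ t)) (Icc 0 L) :=
  continuous_distToBdry.comp_continuousOn h.continuousOn

theorem IsCurve.intervalIntegrable (hd : ∀ x : X, 0 < distToBdry X x) {γ : ℝ → X} {L : ℝ}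
    (h : IsCurve γ L) {a b : ℝ} (ha : 0 ≤ a) (hab : a ≤ b) (hb : b ≤ L) :
    IntervalIntegrable (qhDensity γ) MeasureTheory.volume a b := by
  apply ContinuousOn.intervalIntegrable_of_Icc hab
  exact (h.distToBdry_continuousOn.mono (Icc_subset_Icc ha hb)).inv₀ fun t _ => (hd _).ne'

theorem IsCurve.restrict {γ : ℝ → X} {L : ℝ} (h : IsCurve γ L) {a b : ℝ} (ha : 0 ≤ a)
    (hab : a ≤ b) (hb : b ≤ L) : IsCurve (fun t => γ (a + t)) (b - a) := by
  refine isCurve_of_dist_le (by linarith) fun s t hs hst ht => ?_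
  have := h.dist_le (a := a + s) (b := a + t) (by linarith) (by linarith) (by linarith)
  simpa using this

theorem IsCurve.reverse {γ : ℝ → X} {L : ℝ} (h : IsCurve γ L) :
    IsCurve (fun t => γ (L - t)) L := by
  refine isCurve_of_dist_le h.1 fun s t hs hst ht => ?_
  rw [dist_comm]
  have := h.dist_le (a := L - t) (b := L - s) (by linarith) (by linarith) (by linarith)
  linarith

theorem IsCurve.concat {γ₁ γ₂ : ℝ → X} {L₁ L₂ : ℝ} (h₁ : IsCurve γ₁ L₁) (h₂ : IsCurve γ₂ L₂)
    (h : γ₁ L₁ = γ₂ 0) : IsCurve (fun t => if t ≤ L₁ then γ₁ t else γ₂ (t - L₁)) (L₁ + L₂) := by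
  refine isCurve_of_dist_le (add_nonneg h₁.1 h₂.1) fun s t hs hst ht => ?_
  have := h₁.1
  have := h₂.1
  by_cases h1 : t ≤ L₁
  · simp only [hst.trans h1, h1, if_true]
    exact h₁.dist_le hs hst h1
  · by_cases h2 : s ≤ L₁
    · simp only [h1, h2, if_true, if_false]
      push Not at h1
      have e1 := h₁.dist_le hs h2 le_rfl
      have e2 := h₂.dist_le (a := 0) (b := t - L₁) le_rfl (by linarith) (by linarith)
      have := dist_triangle (γ₁ s) (γ₁ L₁) (γ₂ (t - L₁))
      rw [← h] at e2
      linarith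
    · simp only [h1, h2, if_false]
      push Not at h1 h2
      have := h₂.dist_le (a := s - L₁) (b := t - L₁) (by linarith) (by linarith) (by linarith)
      linarith

theorem quasihyperbolic_set_bddBelow (x y : X) :
    BddBelow {r : ℝ | ∃ L : ℝ, 0 ≤ L ∧ ∃ γ : ℝ → X,
    LipschitzOnWith 1 γ (Set.Icc 0 L) ∧ γ 0 = x ∧ γ L = y ∧
    r = ∫ t in (0:ℝ)..L, (distToBdry X (γ t))⁻¹} := by
  refine ⟨0, ?_⟩
  rintro r ⟨L, hL, γ, -, -, -, rfl⟩
  exact intervalIntegral.integral_nonneg hL fun t _ => qhDensity_nonneg γ t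

theorem IsCurve.quasihyperbolic_le {γ : ℝ → X} {L : ℝ} (h : IsCurve γ L) :
    quasihyperbolic X (γ 0) (γ L) ≤ ∫ t in (0:ℝ)..L, qhDensity γ t :=
  csInf_le (quasihyperbolic_set_bddBelow _ _) ⟨L, h.1, γ, h.2, rfl, rfl, rfl⟩

theorem IsCurve.quasihyperbolic_le_integral {γ : ℝ → X} {L : ℝ} (h : IsCurve γ L) {a b : ℝ}
    (ha : 0 ≤ a) (hab : a ≤ b) (hb : b ≤ L) :
    quasihyperbolic X (γ a) (γ b) ≤ ∫ t in a..b, qhDensity γ t := by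
  have := (h.restrict ha hab hb).quasihyperbolic_le
  have e : ∫ t in (0:ℝ)..(b - a), qhDensity (fun t => γ (a + t)) t =
      ∫ t in a..b, qhDensity γ t := by
    have := intervalIntegral.integral_comp_add_left (a := 0) (b := b - a) (qhDensity γ) a
    rw [add_zero, add_sub_cancel] at this
    exact this
  rw [e] at this
  simpa using this

theorem exists_curve_lt {A : ℝ} (hX : IsUniformMS X A) (x y : X) {c : ℝ}
    (hc : quasihyperbolic X x y < c) :
    ∃ (L : ℝ) (γ : ℝ → X), IsCurve γ L ∧ γ 0 = x ∧ γ L = y ∧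
      ∫ t in (0:ℝ)..L, qhDensity γ t < c := by
  have hne : {r : ℝ | ∃ L : ℝ, 0 ≤ L ∧ ∃ γ : ℝ → X,
    LipschitzOnWith 1 γ (Set.Icc 0 L) ∧ γ 0 = x ∧ γ L = y ∧
    r = ∫ t in (0:ℝ)..L, (distToBdry X (γ t))⁻¹}.Nonempty := by
    obtain ⟨L, hL, γ, h1, h2, h3, -⟩ := hX x y
    exact ⟨_, L, hL, γ, h1, h2, h3, rfl⟩
  obtain ⟨r, ⟨L, hL, γ, h1, h2, h3, rfl⟩, hr⟩ := exists_lt_of_csInf_lt hne hc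
  exact ⟨L, γ, ⟨hL, h1⟩, h2, h3, hr⟩

theorem integral_qhDensity_reverse (γ : ℝ → X) (L a b : ℝ) :
    ∫ t in a..b, qhDensity (fun t => γ (L - t)) t = ∫ t in (L - b)..(L - a), qhDensity γ t :=
  intervalIntegral.integral_comp_sub_left (qhDensity γ) L

theorem quasihyperbolic_comm_le {A : ℝ} (hX : IsUniformMS X A) (x y : X) :
    quasihyperbolic X x y ≤ quasihyperbolic X y x := by
  refine le_of_forall_gt fun c hc => ?_
  obtain ⟨L, γ, h, rfl, rfl, hlt⟩ := exists_curve_lt hX y x hc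
  have := h.reverse.quasihyperbolic_le
  rw [integral_qhDensity_reverse] at this
  simp only [sub_zero, sub_self] at this
  exact this.trans_lt hlt

theorem quasihyperbolic_comm {A : ℝ} (hX : IsUniformMS X A) (x y : X) :
    quasihyperbolic X x y = quasihyperbolic X y x :=
  le_antisymm (quasihyperbolic_comm_le hX x y) (quasihyperbolic_comm_le hX y x)

theorem quasihyperbolic_triangle {A : ℝ} (hX : IsUniformMS X A)
    (hd : ∀ x : X, 0 < distToBdry X x) (x y z : X) :
    quasihyperbolic X x z ≤ quasihyperbolic X x y + quasihyperbolic X y z := by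
  refine le_of_forall_pos_le_add fun ε hε => ?_
  obtain ⟨L₁, γ₁, h₁, hx, hy, hlt₁⟩ := exists_curve_lt hX x y
    (c := quasihyperbolic X x y + ε / 2) (by linarith)
  obtain ⟨L₂, γ₂, h₂, hy', hz, hlt₂⟩ := exists_curve_lt hX y z
    (c := quasihyperbolic X y z + ε / 2) (by linarith)
  have hj : γ₁ L₁ = γ₂ 0 := hy.trans hy'.symm
  have hc := h₁.concat h₂ hj
  set γ : ℝ → X := fun t => if t ≤ L₁ then γ₁ t else γ₂ (t - L₁) with hγ
  have hL₁ := h₁.1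
  have hL₂ := h₂.1
  have e0 : γ 0 = x := by simp [hγ, hL₁, hx]
  have eq₂ : ∀ t, L₁ ≤ t → γ t = γ₂ (t - L₁) := by
    intro t ht
    rcases ht.eq_or_lt with rfl | ht
    · simp [hγ, hj]
    · simp [hγ, not_le.2 ht]
  have e1 : γ (L₁ + L₂) = z := by rw [eq₂ _ (by linarith)]; simpa using hz
  have key := hc.quasihyperbolic_le
  rw [e0, e1, ← intervalIntegral.integral_add_adjacent_intervals
    (hc.intervalIntegrable hd le_rfl hL₁ (by linarith))
    (hc.intervalIntegrable hd hL₁ (by linarith) le_rfl)] at key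
  have i1 : ∫ t in (0:ℝ)..L₁, qhDensity γ t = ∫ t in (0:ℝ)..L₁, qhDensity γ₁ t := by
    refine intervalIntegral.integral_congr fun t ht => ?_
    rw [uIcc_of_le hL₁] at ht
    simp [qhDensity, hγ, ht.2]
  have i2 : ∫ t in L₁..(L₁ + L₂), qhDensity γ t = ∫ t in (0:ℝ)..L₂, qhDensity γ₂ t := by
    have : ∫ t in L₁..(L₁ + L₂), qhDensity γ t =
        ∫ t in L₁..(L₁ + L₂), qhDensity γ₂ (t - L₁) := by
      refine intervalIntegral.integral_congr fun t ht => ?_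
      rw [uIcc_of_le (by linarith)] at ht
      simp [qhDensity, eq₂ t ht.1]
    rw [this, intervalIntegral.integral_comp_sub_right]
    simp
  rw [i1, i2] at key
  linarith

theorem integral_inv_add (c L : ℝ) (hc : 0 < c) (hL : 0 ≤ L) :
    ∫ t in (0:ℝ)..L, (c + t)⁻¹ = Real.log ((c + L) / c) := by
  rw [intervalIntegral.integral_comp_add_left (fun t => t⁻¹) c, add_zero,
    integral_inv_of_pos hc (by linarith)]

theorem intervalIntegrable_inv_add (c L : ℝ) (hc : 0 < c) (hL : 0 ≤ L) :
    IntervalIntegrable (fun t => (c + t)⁻¹) MeasureTheory.volume 0 L := by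
  apply ContinuousOn.intervalIntegrable_of_Icc hL
  refine ContinuousOn.inv₀ (by fun_prop) fun t ht => ?_
  have := ht.1
  positivity

/-- In a uniform space the quasihyperbolic metric is at most logarithmic. -/
theorem IsUniformMS.quasihyperbolic_le_log {A : ℝ} (hA : 1 ≤ A) (hX : IsUniformMS X A)
    (hd : ∀ x : X, 0 < distToBdry X x) (x y : X) :
    quasihyperbolic X x y ≤ (2 * A + 1) *
      Real.log (A ^ 2 * (bdrySum x y ^ 2 / (distToBdry X x * distToBdry X y))) := by
  obtain ⟨L, hL, γ, hγ, hx, hy, hlen, hcone⟩ := hX x y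
  have hc : IsCurve γ L := ⟨hL, hγ⟩
  have hdx := hd x
  have hdy := hd y
  have key := hc.quasihyperbolic_le
  rw [hx, hy] at key
  have hint : ∫ t in (0:ℝ)..L, qhDensity γ t ≤
      ∫ t in (0:ℝ)..L, (2 * A + 1) *
        ((distToBdry X x + t)⁻¹ + (distToBdry X y + (L - t))⁻¹) := by
    have hi := intervalIntegrable_inv_add _ L hdx hL
    have hi2 := (intervalIntegrable_inv_add _ L hdy hL).comp_sub_left L
    simp only [sub_zero, sub_self] at hi2
    refine intervalIntegral.integral_mono_on hL (hc.intervalIntegrable hd le_rfl hL le_rfl)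
      ((hi.add hi2.symm).const_mul _) fun t ht => ?_
    have hp := hd (γ t)
    have l1 := distToBdry_le_add_dist x (γ t)
    have l2 := distToBdry_le_add_dist y (γ t)
    have l3 := hc.dist_le le_rfl ht.1 ht.2
    have l4 := hc.dist_le ht.1 ht.2 le_rfl
    rw [hx] at l3
    rw [hy, dist_comm] at l4
    have l5 := hcone t ht
    have ht1 := ht.1
    have ht2 := ht.2
    have p1 : 0 < distToBdry X x + t := by linarith
    have p2 : 0 < distToBdry X y + (L - t) := by linarith
    have step : ∀ u : ℝ, 0 < u → u ≤ (2 * A + 1) * distToBdry X (γ t) →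
        qhDensity γ t ≤ (2 * A + 1) * u⁻¹ := by
      intro u hu h
      unfold qhDensity
      rw [← div_eq_mul_inv, le_div_iff₀ hu, inv_mul_le_iff₀ hp]
      linarith
    have q1 : 0 ≤ (2 * A + 1) * (distToBdry X x + t)⁻¹ := by positivity
    have q2 : 0 ≤ (2 * A + 1) * (distToBdry X y + (L - t))⁻¹ := by positivity
    rw [mul_add]
    rcases min_le_iff.1 l5 with h | h
    · have := step _ p1 (by nlinarith)
      linarith
    · have := step _ p2 (by nlinarith)
      linarith
  refine key.trans (hint.trans ?_)
  rw [intervalIntegral.integral_const_mul]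
  refine mul_le_mul_of_nonneg_left ?_ (by linarith)
  have hi := intervalIntegrable_inv_add _ L hdx hL
  have hi2 := (intervalIntegrable_inv_add _ L hdy hL).comp_sub_left L
  simp only [sub_zero, sub_self] at hi2
  rw [intervalIntegral.integral_add hi hi2.symm, integral_inv_add _ _ hdx hL,
    intervalIntegral.integral_comp_sub_left (fun t => (distToBdry X y + t)⁻¹) L, sub_self,
    sub_zero, integral_inv_add _ _ hdy hL,
    ← Real.log_mul (by positivity) (by positivity)]
  refine Real.log_le_log (by positivity) ?_
  have hxy := dist_nonneg (x := x) (y := y)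
  have b1 : distToBdry X x + L ≤ A * bdrySum x y := by unfold bdrySum; nlinarith
  have b2 : distToBdry X y + L ≤ A * bdrySum x y := by unfold bdrySum; nlinarith
  rw [div_mul_div_comm, ← mul_div_assoc]
  refine div_le_div_of_nonneg_right ?_ (by positivity)
  calc _ ≤ (A * bdrySum x y) * (A * bdrySum x y) :=
        mul_le_mul b1 b2 (by linarith) (by linarith)
    _ = _ := by ring

/-- A curve whose quasihyperbolic length between any two of its points is controlled by the
logarithmic bound valid in uniform spaces. -/
structure ShortCurve (A : ℝ) (γ : ℝ → X) (L : ℝ) : Prop where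
  curve : IsCurve γ L
  integral_le : ∀ a b, 0 ≤ a → a ≤ b → b ≤ L → ∫ t in a..b, qhDensity γ t ≤
    (2 * A + 1) * Real.log (A ^ 2 * (bdrySum (γ a) (γ b) ^ 2 /
      (distToBdry X (γ a) * distToBdry X (γ b)))) + 1

theorem ShortCurve.reverse {A : ℝ} {γ : ℝ → X} {L : ℝ} (h : ShortCurve A γ L) :
    ShortCurve A (fun t => γ (L - t)) L where
  curve := h.curve.reverse
  integral_le a b ha hab hb := by
    have := h.integral_le (L - b) (L - a) (by linarith) (by linarith) (by linarith)
    rw [integral_qhDensity_reverse, bdrySum_comm,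
      mul_comm (distToBdry X (γ (L - a)))]
    exact this

theorem IsCurve.shortCurve {A : ℝ} (hA : 1 ≤ A) (hX : IsUniformMS X A)
    (hd : ∀ x : X, 0 < distToBdry X x) {γ : ℝ → X} {L : ℝ} (h : IsCurve γ L)
    (hk : ∫ t in (0:ℝ)..L, qhDensity γ t ≤ quasihyperbolic X (γ 0) (γ L) + 1) :
    ShortCurve A γ L where
  curve := h
  integral_le a b ha hab hb := by
    refine le_trans ?_ (add_le_add_left (hX.quasihyperbolic_le_log hA hd (γ a) (γ b)) 1)
    have t1 := quasihyperbolic_triangle hX hd (γ 0) (γ a) (γ L)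
    have t2 := quasihyperbolic_triangle hX hd (γ a) (γ b) (γ L)
    have k1 := h.quasihyperbolic_le_integral le_rfl ha (hab.trans hb)
    have k2 := h.quasihyperbolic_le_integral (ha.trans hab) hb le_rfl
    rw [← intervalIntegral.integral_add_adjacent_intervals
      (h.intervalIntegrable hd le_rfl ha (hab.trans hb))
      (h.intervalIntegrable hd ha (hab.trans hb) le_rfl),
      ← intervalIntegral.integral_add_adjacent_intervals
      (h.intervalIntegrable hd ha hab hb)
      (h.intervalIntegrable hd (ha.trans hab) hb le_rfl)] at hk
    linarith

theorem IsCurve.log_div_le_integral (hd : ∀ x : X, 0 < distToBdry X x) {γ : ℝ → X} {L : ℝ}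
    (h : IsCurve γ L) {a b : ℝ} (ha : 0 ≤ a) (hab : a ≤ b) (hb : b ≤ L) :
    Real.log (distToBdry X (γ b) / distToBdry X (γ a)) ≤ ∫ t in a..b, qhDensity γ t := by
  have ha' := hd (γ a)
  have hb' := hd (γ b)
  have e : ∫ t in a..b, (distToBdry X (γ a) + (t - a))⁻¹ =
      Real.log ((distToBdry X (γ a) + (b - a)) / distToBdry X (γ a)) := by
    rw [intervalIntegral.integral_comp_sub_right (fun t => (distToBdry X (γ a) + t)⁻¹) a,
      sub_self, integral_inv_add _ _ ha' (by linarith)]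
  have l1 := distToBdry_le_add_dist (γ b) (γ a)
  have l2 := h.dist_le ha hab hb
  rw [dist_comm] at l1
  calc _ ≤ Real.log ((distToBdry X (γ a) + (b - a)) / distToBdry X (γ a)) := by
        refine Real.log_le_log (by positivity) ?_
        exact div_le_div_of_nonneg_right (by linarith) ha'.le
    _ ≤ _ := by
        rw [← e]
        refine intervalIntegral.integral_mono_on hab ?_
          (h.intervalIntegrable hd ha hab hb) fun t ht => ?_
        · have := (intervalIntegrable_inv_add _ (b - a) ha' (by linarith)).comp_sub_right a
          simpa using this
        · refine inv_anti₀ (hd _) ?_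
          have l1 := distToBdry_le_add_dist (γ t) (γ a)
          have l2 := h.dist_le ha ht.1 (ht.2.trans hb)
          rw [dist_comm] at l1
          linarith

theorem IsCurve.div_le_integral (hd : ∀ x : X, 0 < distToBdry X x) {γ : ℝ → X} {L : ℝ}
    (h : IsCurve γ L) {a b E : ℝ} (ha : 0 ≤ a) (hab : a ≤ b) (hb : b ≤ L)
    (hE : ∀ t ∈ Icc a b, distToBdry X (γ t) ≤ E) :
    (b - a) / E ≤ ∫ t in a..b, qhDensity γ t := by
  have : ∫ _ in a..b, E⁻¹ = (b - a) / E := by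
    rw [intervalIntegral.integral_const, smul_eq_mul, div_eq_mul_inv]
  rw [← this]
  refine intervalIntegral.integral_mono_on hab (by simp)
    (h.intervalIntegrable hd ha hab hb) fun t ht => inv_anti₀ (hd _) (hE t ht)

theorem le_of_le_mul_log {A τ : ℝ} (hA : 1 ≤ A) (hτ : 0 ≤ τ)
    (h : τ ≤ (2 * A + 1) * Real.log (4 * A ^ 2 * (τ + 2) ^ 2) + 1) :
    τ ≤ 4 * (2 * A + 1) * Real.log (8 * A * (2 * A + 1)) + 4 := by
  have e : 4 * A ^ 2 * (τ + 2) ^ 2 = (2 * A * (τ + 2)) ^ 2 := by ring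
  rw [e, Real.log_pow] at h
  have p : 0 < 8 * A * (2 * A + 1) := by positivity
  have h1 := Real.log_le_sub_one_of_pos (x := (2 * A * (τ + 2)) / (8 * A * (2 * A + 1)))
    (by positivity)
  rw [Real.log_div (by positivity) (by positivity)] at h1
  have e2 : (2 * A * (τ + 2)) / (8 * A * (2 * A + 1)) = (τ + 2) / (4 * (2 * A + 1)) := by
    field_simp; ring
  rw [e2] at h1
  have h2 : (2 * A + 1) * ((τ + 2) / (4 * (2 * A + 1))) = (τ + 2) / 4 := by field_simp
  push_cast at h
  nlinarith

/-- Every arc of the curve along which the distance to the boundary is comparable to a fixed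
scale `E` has length at most `C * E` and quasihyperbolic length at most `C`. -/
def ScaleBounded (C : ℝ) (γ : ℝ → X) (L : ℝ) : Prop :=
  ∀ a b E : ℝ, 0 ≤ a → a ≤ b → b ≤ L → 0 < E →
    (∀ t ∈ Icc a b, distToBdry X (γ t) ≤ E) → E ≤ 2 * distToBdry X (γ a) →
    E ≤ 2 * distToBdry X (γ b) → b - a ≤ C * E ∧ ∫ t in a..b, qhDensity γ t ≤ C

theorem ShortCurve.exists_scaleBounded {A : ℝ} (hA : 1 ≤ A) :
    ∃ C : ℝ, 1 ≤ C ∧ ∀ (X : Type u) [MetricSpace X], (∀ x : X, 0 < distToBdry X x) →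
      ∀ (γ : ℝ → X) (L : ℝ), ShortCurve A γ L → ScaleBounded C γ L := by
  set C₁ := 4 * (2 * A + 1) * Real.log (8 * A * (2 * A + 1)) + 4 with hC₁
  set C₂ := (2 * A + 1) * Real.log (4 * A ^ 2 * (C₁ + 2) ^ 2) + 1 with hC₂
  have hl : 0 ≤ Real.log (8 * A * (2 * A + 1)) := Real.log_nonneg (by nlinarith)
  have hC₁' : 1 ≤ C₁ := by
    have : 0 ≤ 4 * (2 * A + 1) * Real.log (8 * A * (2 * A + 1)) := by positivity
    linarith
  refine ⟨max C₁ C₂, le_max_of_le_left hC₁', ?_⟩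
  intro X _ hd γ L h a b E ha hab hb hE hmax hEa hEb
  have hi := h.integral_le a b ha hab hb
  have hlow := h.curve.div_le_integral hd ha hab hb hmax
  have hda := hd (γ a)
  have hdb := hd (γ b)
  set τ := (b - a) / E with hτ
  have hτ0 : 0 ≤ τ := div_nonneg (by linarith) hE.le
  have hba : b - a = τ * E := by rw [hτ]; field_simp
  have hup : ∫ t in a..b, qhDensity γ t ≤
      (2 * A + 1) * Real.log (4 * A ^ 2 * (τ + 2) ^ 2) + 1 := by
    refine hi.trans (add_le_add_left (mul_le_mul_of_nonneg_left ?_ (by linarith)) 1)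
    have hs := bdrySum_pos hd (γ a) (γ b)
    refine Real.log_le_log (by positivity) ?_
    have hs2 : bdrySum (γ a) (γ b) ≤ E * (τ + 2) := by
      have := h.curve.dist_le ha hab hb
      have := hmax a ⟨le_rfl, hab⟩
      have := hmax b ⟨hab, le_rfl⟩
      unfold bdrySum
      linarith
    have hsq : bdrySum (γ a) (γ b) ^ 2 ≤ (E * (τ + 2)) ^ 2 := pow_le_pow_left₀ hs.le hs2 2
    have hEE : E * E ≤ 4 * (distToBdry X (γ a) * distToBdry X (γ b)) := by nlinarith
    have : bdrySum (γ a) (γ b) ^ 2 / (distToBdry X (γ a) * distToBdry X (γ b)) ≤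
        4 * (τ + 2) ^ 2 := by
      rw [div_le_iff₀ (by positivity)]
      nlinarith [mul_le_mul_of_nonneg_left hEE (sq_nonneg (τ + 2))]
    nlinarith [mul_le_mul_of_nonneg_left this (sq_nonneg A)]
  have hτ1 : τ ≤ C₁ := le_of_le_mul_log hA hτ0 (hlow.trans hup)
  constructor
  · rw [hba]
    exact mul_le_mul_of_nonneg_right (le_max_of_le_left hτ1) hE.le
  · refine le_max_of_le_right (hup.trans (add_le_add_left
      (mul_le_mul_of_nonneg_left ?_ (by linarith)) 1))
    refine Real.log_le_log (by positivity) ?_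
    gcongr

/-- If `d ∘ γ` attains its maximum over `[0, t]` at `t`, then `t` is at most a multiple of it. -/
theorem ScaleBounded.le_of_isMax (hd : ∀ x : X, 0 < distToBdry X x) {C : ℝ} (hC : 1 ≤ C)
    {γ : ℝ → X} {L : ℝ} (hγ : IsCurve γ L) (h : ScaleBounded C γ L) {t : ℝ} (ht : t ∈ Icc 0 L)
    (hmax : ∀ r ∈ Icc 0 t, distToBdry X (γ r) ≤ distToBdry X (γ t)) :
    t ≤ 2 * C * distToBdry X (γ t) := by
  have main : ∀ n : ℕ, ∀ t ∈ Icc 0 L,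
      (∀ r ∈ Icc 0 t, distToBdry X (γ r) ≤ distToBdry X (γ t)) →
      distToBdry X (γ t) ≤ 2 ^ n * distToBdry X (γ 0) → t ≤ 2 * C * distToBdry X (γ t) := by
    have base : ∀ t ∈ Icc 0 L,
        (∀ r ∈ Icc 0 t, distToBdry X (γ r) ≤ distToBdry X (γ t)) →
        distToBdry X (γ t) ≤ 2 * distToBdry X (γ 0) → t ≤ 2 * C * distToBdry X (γ t) := by
      intro t ht hmax h2
      have hp := hd (γ t)
      have := (h 0 t _ le_rfl ht.1 ht.2 hp hmax h2 (by linarith)).1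
      nlinarith
    intro n
    induction n with
    | zero =>
      intro t ht hmax h1
      exact base t ht hmax (by linarith [hd (γ 0)])
    | succ n ih =>
      intro t ht hmax h1
      by_cases h2 : distToBdry X (γ t) ≤ 2 * distToBdry X (γ 0)
      · exact base t ht hmax h2
      push Not at h2
      have hp := hd (γ t)
      obtain ⟨s, hs, hse, hsm⟩ := exists_first_hit (c := distToBdry X (γ t) / 2) ht.1
        (hγ.distToBdry_continuousOn.mono (Icc_subset_Icc_right ht.2)) (by linarith) (by linarith)
      have i1 := ih s ⟨hs.1, hs.2.trans ht.2⟩ (fun r hr => by rw [hse]; exact hsm r hr)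
        (by rw [hse]; rw [pow_succ] at h1; linarith)
      have i2 := (h s t _ hs.1 hs.2 ht.2 hp (fun r hr => hmax r ⟨hs.1.trans hr.1, hr.2⟩)
        (by linarith) (by linarith)).1
      rw [hse] at i1
      nlinarith
  obtain ⟨n, hn⟩ := pow_unbounded_of_one_lt (distToBdry X (γ t) / distToBdry X (γ 0))
    (one_lt_two (α := ℝ))
  rw [div_lt_iff₀ (hd _)] at hn
  exact main n t ht hmax hn.le

/-- Before a maximum point of `d ∘ γ`, the curve satisfies a cone condition. -/
theorem ScaleBounded.cone (hd : ∀ x : X, 0 < distToBdry X x) {C : ℝ} (hC : 1 ≤ C)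
    {γ : ℝ → X} {L : ℝ} (hγ : IsCurve γ L) (h : ScaleBounded C γ L) {t m : ℝ} (ht : 0 ≤ t)
    (htm : t ≤ m) (hm : m ≤ L)
    (hmax : ∀ r ∈ Icc 0 L, distToBdry X (γ r) ≤ distToBdry X (γ m)) :
    t ≤ 3 * C * Real.exp C * distToBdry X (γ t) := by
  obtain ⟨u, hu, hu'⟩ := isCompact_Icc.exists_isMaxOn (nonempty_Icc.2 ht)
    (hγ.distToBdry_continuousOn.mono (Icc_subset_Icc_right (htm.trans hm)))
  have hu' : ∀ r ∈ Icc 0 t, distToBdry X (γ r) ≤ distToBdry X (γ u) := fun r hr => hu' hr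
  have hu0 := hu.1
  have hut := hu.2
  obtain ⟨v, hv, hve, hvm⟩ := exists_first_hit (c := distToBdry X (γ u)) htm
    (hγ.distToBdry_continuousOn.mono (Icc_subset_Icc ht hm))
    (hu' t ⟨ht, le_rfl⟩) (hmax u ⟨hu0, by linarith⟩)
  have hvt := hv.1
  have hvL := hv.2.trans hm
  have hup := hd (γ u)
  have htp := hd (γ t)
  have hb := h u v _ hu0 (hut.trans hvt) hvL hup (fun r hr => by
    rcases le_total r t with hrt | hrt
    · exact hu' r ⟨hu0.trans hr.1, hrt⟩
    · exact hvm r ⟨hrt, hr.2⟩) (by linarith) (by linarith)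
  have hrec := h.le_of_isMax hd hC hγ ⟨hu0, by linarith⟩
    (fun r hr => hu' r ⟨hr.1, hr.2.trans hut⟩)
  have hlog := hγ.log_div_le_integral hd ht hvt hvL
  rw [hve] at hlog
  have hsub : ∫ r in t..v, qhDensity γ r ≤ ∫ r in u..v, qhDensity γ r :=
    intervalIntegral.integral_mono_interval hut hvt le_rfl
      (Filter.Eventually.of_forall fun r => qhDensity_nonneg γ r)
      (hγ.intervalIntegrable hd hu0 (hut.trans hvt) hvL)
  have hexp := (Real.log_le_iff_le_exp (by positivity)).1 (hlog.trans (hsub.trans hb.2))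
  rw [div_le_iff₀ htp] at hexp
  calc t ≤ 3 * C * distToBdry X (γ u) := by linarith [hb.1]
    _ ≤ 3 * C * (Real.exp C * distToBdry X (γ t)) :=
        mul_le_mul_of_nonneg_left hexp (by linarith)
    _ = _ := by ring

/-- The points of a short curve lie between its end points, up to a uniform error. -/
theorem ShortCurve.exists_bdryBetween {A : ℝ} (hA : 1 ≤ A) :
    ∃ C : ℝ, 1 ≤ C ∧ ∀ (X : Type u) [MetricSpace X], (∀ x : X, 0 < distToBdry X x) →
      ∀ (γ : ℝ → X) (L : ℝ), ShortCurve A γ L → ∀ t ∈ Icc 0 L,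
        BdryBetween C (γ 0) (γ L) (γ t) := by
  obtain ⟨C, hC, hbound⟩ := ShortCurve.exists_scaleBounded.{u} hA
  set K := 3 * C * Real.exp C with hK
  have hK0 : 0 ≤ K := by positivity
  set M := Real.exp ((2 * A + 1) * Real.log (A ^ 2 * (3 + 2 * K) ^ 2) + 1) with hM
  have hM1 : 1 ≤ M := by
    rw [hM]
    refine Real.one_le_exp ?_
    have : 0 ≤ Real.log (A ^ 2 * (3 + 2 * K) ^ 2) := by
      refine Real.log_nonneg ?_
      nlinarith [sq_nonneg K, sq_nonneg A, mul_nonneg (sq_nonneg A) hK0]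
    positivity
  have hKM : 0 ≤ (K + 1) * M := by positivity
  refine ⟨(2 * K + 2) * (1 + (K + 1) * M), by nlinarith, ?_⟩
  intro X _ hd
  -- The case of a point before a maximum point of the distance to the boundary.
  have half : ∀ (γ : ℝ → X) (L : ℝ), ShortCurve A γ L → ∀ t m, 0 ≤ t → t ≤ m → m ≤ L →
      (∀ r ∈ Icc 0 L, distToBdry X (γ r) ≤ distToBdry X (γ m)) →
      BdryBetween ((2 * K + 2) * (1 + (K + 1) * M)) (γ 0) (γ L) (γ t) := by
    intro γ L h t m ht htm hm hmax
    have hsb := hbound X hd γ L h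
    have hsbr := hbound X hd _ L h.reverse
    have hc := h.curve
    have hcone : ∀ r, 0 ≤ r → r ≤ m → r ≤ K * distToBdry X (γ r) := fun r hr hrm =>
      hsb.cone hd hC hc hr hrm hm hmax
    have hcone' : ∀ r, m ≤ r → r ≤ L → L - r ≤ K * distToBdry X (γ r) := by
      intro r hmr hrL
      have := hsbr.cone hd hC hc.reverse (t := L - r) (m := L - m) (by linarith) (by linarith)
        (by linarith) (fun q hq => by
          simpa using hmax (L - q) ⟨by linarith [hq.2], by linarith [hq.1]⟩)
      simpa using this
    set S := bdrySum (γ 0) (γ L) with hS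
    have hSp : 0 < S := bdrySum_pos hd _ _
    have h0p := hd (γ 0)
    have hLp := hd (γ L)
    have hdist : 0 ≤ dist (γ 0) (γ L) := dist_nonneg
    have hm0 : 0 ≤ m := ht.trans htm
    have hD : distToBdry X (γ m) ≤ M * S := by
      by_cases hDS : distToBdry X (γ m) ≤ S
      · nlinarith
      push Not at hDS
      obtain ⟨a, ha, hae, -⟩ := exists_first_hit (c := S) hm0
        (hc.distToBdry_continuousOn.mono (Icc_subset_Icc_right hm))
        (by rw [hS]; unfold bdrySum; linarith) hDS.le
      obtain ⟨b, hb, hbe⟩ := intermediate_value_Icc' hm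
        (hc.distToBdry_continuousOn.mono (Icc_subset_Icc_left hm0))
        (show S ∈ Icc _ _ from ⟨by rw [hS]; unfold bdrySum; linarith, hDS.le⟩)
      have hbe : distToBdry X (γ b) = S := hbe
      have c1 := hcone a ha.1 ha.2
      have c2 := hcone' b hb.1 hb.2
      have d1 := hc.dist_le le_rfl ha.1 (ha.2.trans hm)
      have d2 := hc.dist_le (hm0.trans hb.1) hb.2 le_rfl
      have d3 := dist_triangle (γ a) (γ 0) (γ b)
      have d4 := dist_triangle (γ 0) (γ L) (γ b)
      rw [dist_comm (γ a) (γ 0)] at d3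
      rw [dist_comm (γ L) (γ b)] at d4
      rw [hae] at c1
      rw [hbe] at c2
      have hab : bdrySum (γ a) (γ b) ≤ (3 + 2 * K) * S := by
        have : dist (γ 0) (γ L) ≤ S := by rw [hS]; unfold bdrySum; linarith
        unfold bdrySum
        rw [hae, hbe]
        linarith
      have habp := bdrySum_pos hd (γ a) (γ b)
      have i1 := h.integral_le a b ha.1 (ha.2.trans hb.1) hb.2
      have i2 : ∫ r in a..m, qhDensity γ r ≤ ∫ r in a..b, qhDensity γ r :=
        intervalIntegral.integral_mono_interval le_rfl ha.2 hb.1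
          (Filter.Eventually.of_forall fun r => qhDensity_nonneg γ r)
          (hc.intervalIntegrable hd ha.1 (ha.2.trans hb.1) hb.2)
      have i3 := hc.log_div_le_integral hd ha.1 ha.2 hm
      rw [hae, hbe] at i1
      rw [hae] at i3
      have i4 : Real.log (A ^ 2 * (bdrySum (γ a) (γ b) ^ 2 / (S * S))) ≤
          Real.log (A ^ 2 * (3 + 2 * K) ^ 2) := by
        refine Real.log_le_log (by positivity) (mul_le_mul_of_nonneg_left ?_ (sq_nonneg A))
        rw [div_le_iff₀ (by positivity)]
        calc _ ≤ ((3 + 2 * K) * S) ^ 2 := pow_le_pow_left₀ habp.le hab 2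
          _ = _ := by ring
      have i5 : Real.log (distToBdry X (γ m) / S) ≤
          (2 * A + 1) * Real.log (A ^ 2 * (3 + 2 * K) ^ 2) + 1 := by
        have := mul_le_mul_of_nonneg_left i4 (show 0 ≤ 2 * A + 1 by linarith)
        linarith
      rw [Real.log_le_iff_le_exp (div_pos (hd _) hSp), div_le_iff₀ hSp] at i5
      exact i5
    have htL := htm.trans hm
    have hp := hd (γ t)
    have hpM := (hmax t ⟨ht, htL⟩).trans hD
    have d1 := (hc.dist_le le_rfl ht htL).trans (by simpa using hcone t ht htm)
    have e1 := distToBdry_le_add_dist (γ 0) (γ t)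
    have b1 : bdrySum (γ 0) (γ t) ≤ (2 * K + 2) * distToBdry X (γ t) := by
      unfold bdrySum; linarith
    have b2 : bdrySum (γ t) (γ L) ≤ (1 + (K + 1) * M) * S := by
      have e3 := dist_triangle (γ t) (γ 0) (γ L)
      rw [dist_comm (γ t) (γ 0)] at e3
      have e4 : bdrySum (γ t) (γ L) ≤ S + (K + 1) * distToBdry X (γ t) := by
        rw [hS]; unfold bdrySum; linarith
      nlinarith [mul_le_mul_of_nonneg_left hpM (show 0 ≤ K + 1 by linarith)]
    unfold BdryBetween
    calc _ ≤ ((2 * K + 2) * distToBdry X (γ t)) * ((1 + (K + 1) * M) * S) :=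
          mul_le_mul b1 b2 (bdrySum_nonneg _ _) (by positivity)
      _ = _ := by ring
  intro γ L h t ht
  obtain ⟨m, hm, hmax⟩ := isCompact_Icc.exists_isMaxOn (nonempty_Icc.2 h.curve.1)
    h.curve.distToBdry_continuousOn
  have hmax : ∀ r ∈ Icc 0 L, distToBdry X (γ r) ≤ distToBdry X (γ m) := fun r hr => hmax hr
  rcases le_total t m with htm | htm
  · exact half γ L h t m ht.1 htm hm.2 hmax
  · have := half _ L h.reverse (L - t) (L - m) (by linarith [ht.2]) (by linarith)
      (by linarith [hm.1]) (fun q hq => by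
        simpa using hmax (L - q) ⟨by linarith [hq.2], by linarith [hq.1]⟩)
    simpa using this.symm

/-- Along a curve from `x` to `y` there is a point dividing the pair `x, y` in roughly the same
ratio as a given point `p`. -/
theorem IsCurve.exists_same_ratio {γ : ℝ → X} {L : ℝ} (h : IsCurve γ L) (p : X) :
    ∃ t ∈ Icc 0 L,
      bdrySum (γ 0) p * bdrySum (γ t) (γ L) ≤ 4 * (bdrySum (γ 0) (γ t) * bdrySum p (γ L)) ∧
      bdrySum (γ 0) (γ t) * bdrySum p (γ L) ≤ 4 * (bdrySum (γ 0) p * bdrySum (γ t) (γ L)) := by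
  have h0 := h.1
  have hend : ∀ x y : X, bdrySum x x * bdrySum p y ≤ 4 * (bdrySum x p * bdrySum x y) := by
    intro x y
    have hx := distToBdry_nonneg x
    have t1 := bdrySum_triangle p x y
    have e : bdrySum x x = 2 * distToBdry X x := by unfold bdrySum; rw [dist_self]; ring
    have l : ∀ z, distToBdry X x ≤ bdrySum x z := by
      intro z
      have := dist_nonneg (x := x) (y := z)
      have := distToBdry_nonneg z
      unfold bdrySum; linarith
    rw [e]
    rw [bdrySum_comm p x] at t1
    have l1 := l p
    have l2 := l y
    nlinarith [mul_le_mul_of_nonneg_left t1 hx,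
      mul_le_mul_of_nonneg_right l1 (bdrySum_nonneg x y),
      mul_le_mul_of_nonneg_right l2 (bdrySum_nonneg x p)]
  set F : ℝ → ℝ := fun t => bdrySum (γ 0) (γ t) * bdrySum p (γ L) -
    bdrySum (γ 0) p * bdrySum (γ t) (γ L) with hF
  have hFc : ContinuousOn F (Icc 0 L) := by
    have c1 : ContinuousOn (fun t => bdrySum (γ 0) (γ t)) (Icc 0 L) :=
      continuous_bdrySum.comp_continuousOn (continuousOn_const.prodMk h.continuousOn)
    have c2 : ContinuousOn (fun t => bdrySum (γ t) (γ L)) (Icc 0 L) :=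
      continuous_bdrySum.comp_continuousOn (h.continuousOn.prodMk continuousOn_const)
    exact (c1.mul continuousOn_const).sub (continuousOn_const.mul c2)
  have nn : ∀ x y z w : X, 0 ≤ bdrySum x y * bdrySum z w := fun x y z w =>
    mul_nonneg (bdrySum_nonneg _ _) (bdrySum_nonneg _ _)
  by_cases hF0 : 0 ≤ F 0
  · refine ⟨0, ⟨le_rfl, h0⟩, ?_, hend _ _⟩
    have : 0 ≤ bdrySum (γ 0) (γ 0) * bdrySum p (γ L) - bdrySum (γ 0) p * bdrySum (γ 0) (γ L) :=
      hF0
    linarith [nn (γ 0) (γ 0) p (γ L)]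
  by_cases hFL : F L ≤ 0
  · refine ⟨L, ⟨h0, le_rfl⟩, ?_, ?_⟩
    · have := hend (γ L) (γ 0)
      rw [bdrySum_comm p (γ 0), bdrySum_comm (γ L) p, bdrySum_comm (γ L) (γ 0)] at this
      linarith
    · have : bdrySum (γ 0) (γ L) * bdrySum p (γ L) -
        bdrySum (γ 0) p * bdrySum (γ L) (γ L) ≤ 0 := hFL
      linarith [nn (γ 0) p (γ L) (γ L)]
  push Not at hF0 hFL
  obtain ⟨t, ht, hFt⟩ := intermediate_value_Icc h0 hFc ⟨hF0.le, hFL.le⟩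
  have : bdrySum (γ 0) (γ t) * bdrySum p (γ L) - bdrySum (γ 0) p * bdrySum (γ t) (γ L) = 0 := hFt
  refine ⟨t, ht, ?_, ?_⟩
  · linarith [nn (γ 0) (γ t) p (γ L)]
  · linarith [nn (γ 0) p (γ t) (γ L)]

/-- Two points between `x` and `y` that divide this pair in roughly the same ratio are close. -/
theorem BdryBetween.sq_le (hd : ∀ x : X, 0 < distToBdry X x) {C : ℝ} {x y p q : X}
    (hp : BdryBetween C x y p) (hq : BdryBetween C x y q)
    (h₁ : bdrySum x p * bdrySum q y ≤ 4 * (bdrySum x q * bdrySum p y))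
    (h₂ : bdrySum x q * bdrySum p y ≤ 4 * (bdrySum x p * bdrySum q y)) :
    bdrySum p q ^ 2 ≤ 64 * C ^ 2 * (distToBdry X p * distToBdry X q) := by
  have h4 := bdrySum_mul_le_max x y p q
  rw [bdrySum_comm y q] at h4
  unfold BdryBetween at hp hq
  have hs := bdrySum_pos hd x y
  have n1 := bdrySum_nonneg x p
  have n2 := bdrySum_nonneg p y
  have n3 := bdrySum_nonneg x q
  have n4 := bdrySum_nonneg q y
  have n5 := bdrySum_nonneg p q
  have hmul := mul_le_mul hp hq (mul_nonneg n3 n4) ((mul_nonneg n1 n2).trans hp)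
  have hmax : (bdrySum x y * bdrySum p q) ^ 2 ≤
      64 * ((bdrySum x p * bdrySum p y) * (bdrySum x q * bdrySum q y)) := by
    set P := bdrySum x p * bdrySum q y with hP
    set Q := bdrySum x q * bdrySum p y with hQ
    have hP0 : 0 ≤ P := mul_nonneg n1 n4
    have hQ0 : 0 ≤ Q := mul_nonneg n3 n2
    have e : (bdrySum x p * bdrySum p y) * (bdrySum x q * bdrySum q y) = P * Q := by
      rw [hP, hQ]; ring
    have hsq := pow_le_pow_left₀ (mul_nonneg hs.le n5) h4 2
    rw [e]
    refine hsq.trans ?_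
    rw [mul_pow]
    rcases le_total P Q with hPQ | hPQ
    · rw [max_eq_right hPQ]; nlinarith
    · rw [max_eq_left hPQ]; nlinarith
  have hs2 : 0 < bdrySum x y ^ 2 := by positivity
  refine le_of_mul_le_mul_left ?_ hs2
  calc _ = (bdrySum x y * bdrySum p q) ^ 2 := by ring
    _ ≤ _ := hmax
    _ ≤ 64 * _ := mul_le_mul_of_nonneg_left hmul (by norm_num)
    _ = _ := by ring

/-- Points between `x` and `y` are almost on quasihyperbolic geodesics. -/
theorem IsUniformMS.quasihyperbolic_add_le {A C : ℝ} (hA : 1 ≤ A) (hX : IsUniformMS X A)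
    (hd : ∀ x : X, 0 < distToBdry X x)
    (hC : ∀ (γ : ℝ → X) (L : ℝ), ShortCurve A γ L → ∀ t ∈ Icc 0 L,
        BdryBetween C (γ 0) (γ L) (γ t)) {x y p : X} (hp : BdryBetween C x y p) :
    quasihyperbolic X x p + quasihyperbolic X p y ≤ quasihyperbolic X x y +
      (2 * ((2 * A + 1) * Real.log (A ^ 2 * (64 * C ^ 2))) + 1) := by
  obtain ⟨L, γ, hγ, rfl, rfl, hlt⟩ := exists_curve_lt hX x y (lt_add_one _)
  obtain ⟨t, ht, h₁, h₂⟩ := hγ.exists_same_ratio p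
  have hq := hC γ L (hγ.shortCurve hA hX hd hlt.le) t ht
  have hsq := hp.sq_le hd hq h₁ h₂
  have hk : quasihyperbolic X p (γ t) ≤
      (2 * A + 1) * Real.log (A ^ 2 * (64 * C ^ 2)) := by
    refine (hX.quasihyperbolic_le_log hA hd _ _).trans
      (mul_le_mul_of_nonneg_left ?_ (by linarith))
    have := bdrySum_pos hd p (γ t)
    have := hd p
    have := hd (γ t)
    refine Real.log_le_log (by positivity) (mul_le_mul_of_nonneg_left ?_ (sq_nonneg A))
    rwa [div_le_iff₀ (by positivity)]
  have k1 := hγ.quasihyperbolic_le_integral le_rfl ht.1 ht.2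
  have k2 := hγ.quasihyperbolic_le_integral ht.1 ht.2 le_rfl
  rw [← intervalIntegral.integral_add_adjacent_intervals
    (hγ.intervalIntegrable hd le_rfl ht.1 ht.2)
    (hγ.intervalIntegrable hd ht.1 ht.2 le_rfl)] at hlt
  have t1 := quasihyperbolic_triangle hX hd (γ 0) (γ t) p
  have t2 := quasihyperbolic_triangle hX hd p (γ t) (γ L)
  rw [quasihyperbolic_comm hX (γ t) p] at t1
  linarith

/-- On a curve all of whose points are between its end points, some point is the centre of the
triangle spanned by the end points and a third point. -/
theorem IsCurve.exists_centre (hd : ∀ x : X, 0 < distToBdry X x) {C : ℝ} (hC : 1 ≤ C)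
    {γ : ℝ → X} {L : ℝ} (h : IsCurve γ L)
    (hb : ∀ t ∈ Icc 0 L, BdryBetween C (γ 0) (γ L) (γ t)) (w : X) :
    ∃ t ∈ Icc 0 L, BdryBetween (4 * C) (γ 0) w (γ t) ∧ BdryBetween (4 * C) w (γ L) (γ t) := by
  have hself : ∀ x z : X, BdryBetween (4 * C) x z x := by
    intro x z
    have e : bdrySum x x = 2 * distToBdry X x := by unfold bdrySum; rw [dist_self]; ring
    unfold BdryBetween
    rw [e]
    have := mul_nonneg (bdrySum_nonneg x z) (distToBdry_nonneg x)
    nlinarith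
  have hc1 : ∀ z : X, ContinuousOn (fun t => bdrySum z (γ t)) (Icc 0 L) := fun z =>
    continuous_bdrySum.comp_continuousOn (continuousOn_const.prodMk h.continuousOn)
  have hc2 : ∀ z : X, ContinuousOn (fun t => bdrySum (γ t) z) (Icc 0 L) := fun z =>
    continuous_bdrySum.comp_continuousOn (h.continuousOn.prodMk continuousOn_const)
  have hclosed : ∀ x y : X, IsClosed (Icc 0 L ∩ {t | BdryBetween (4 * C) x y (γ t)}) := by
    intro x y
    have hF : ContinuousOn (fun t => 4 * C * (bdrySum x y * distToBdry X (γ t)) -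
        bdrySum x (γ t) * bdrySum (γ t) y) (Icc 0 L) :=
      (continuousOn_const.mul (continuousOn_const.mul h.distToBdry_continuousOn)).sub
        ((hc1 x).mul (hc2 y))
    have := hF.preimage_isClosed_of_isClosed isClosed_Icc (isClosed_Ici (a := (0 : ℝ)))
    convert this using 2
    ext t
    simp [BdryBetween]
  have h0 := h.1
  obtain ⟨t, ht, ht₁, ht₂⟩ := isPreconnected_closed_iff.1 (isPreconnected_Icc (a := 0) (b := L))
    _ _ (hclosed (γ 0) w) (hclosed w (γ L))
    (fun t ht => ((hb t ht).or hd (by linarith) w).imp (fun h => ⟨ht, h⟩) (fun h => ⟨ht, h⟩))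
    ⟨0, ⟨le_rfl, h0⟩, ⟨le_rfl, h0⟩, hself _ _⟩
    ⟨L, ⟨h0, le_rfl⟩, ⟨h0, le_rfl⟩, (hself _ _).symm⟩
  exact ⟨t, ht, ht₁.2, ht₂.2⟩

end Auxiliary

/-- the quasihyperbolic metric of an A-uniform space is
δ-hyperbolic with δ depending only on A. -/
theorem quasihyperbolic_hyperbolic_of_uniform (A : ℝ) (hA : 1 ≤ A) :
    ∃ δ : ℝ, 0 ≤ δ ∧
      ∀ (X : Type u) [MetricSpace X], IsUniformMS X A →
        (∀ x : X, 0 < distToBdry X x) →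
        IsDeltaHyp (quasihyperbolic X) δ := by
  obtain ⟨C, hC1, hC⟩ := ShortCurve.exists_bdryBetween.{u} hA
  set c := 2 * ((2 * A + 1) * Real.log (A ^ 2 * (64 * (4 * C) ^ 2))) + 1 with hc
  have hc0 : 0 ≤ c := by
    have : 0 ≤ Real.log (A ^ 2 * (64 * (4 * C) ^ 2)) := by
      refine Real.log_nonneg ?_
      have h1 : 1 ≤ A ^ 2 := one_le_pow₀ hA
      have h2 : 1 ≤ C ^ 2 := one_le_pow₀ hC1
      nlinarith
    have : 0 ≤ 2 * A + 1 := by linarith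
    positivity
  refine ⟨2 * c, by linarith, ?_⟩
  intro X _ hX hd x y z w
  have key : ∀ {x y p : X}, BdryBetween (4 * C) x y p →
      quasihyperbolic X x p + quasihyperbolic X p y ≤ quasihyperbolic X x y + c :=
    fun hp => hX.quasihyperbolic_add_le hA hd
      (fun γ L h t ht => (hC X hd γ L h t ht).mono (by linarith)) hp
  obtain ⟨L, γ, hγ, rfl, rfl, hlt⟩ := exists_curve_lt hX x y (lt_add_one _)
  have hb := hC X hd γ L (hγ.shortCurve hA hX hd hlt.le)
  obtain ⟨t, ht, hxw, hwy⟩ := hγ.exists_centre hd hC1 hb w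
  have k1 := key hxw
  have k2 := key hwy
  have t1 := quasihyperbolic_triangle hX hd (γ 0) (γ t) (γ L)
  have t2 := quasihyperbolic_triangle hX hd (γ 0) (γ t) w
  have t3 := quasihyperbolic_triangle hX hd z (γ t) w
  have t4 := quasihyperbolic_triangle hX hd w (γ t) (γ L)
  have s1 := quasihyperbolic_comm hX w (γ t)
  have s2 := quasihyperbolic_comm hX w (γ L)
  have s3 := quasihyperbolic_comm hX z (γ t)
  unfold gromovProd
  rcases (hb t ht).or hd (by linarith) z with h | h
  · have k3 := key h
    have := min_le_left
      ((quasihyperbolic X (γ 0) w + quasihyperbolic X z w - quasihyperbolic X (γ 0) z) / 2)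
      ((quasihyperbolic X z w + quasihyperbolic X (γ L) w - quasihyperbolic X z (γ L)) / 2)
    linarith
  · have k3 := key h
    have := min_le_right
      ((quasihyperbolic X (γ 0) w + quasihyperbolic X z w - quasihyperbolic X (γ 0) z) / 2)
      ((quasihyperbolic X z w + quasihyperbolic X (γ L) w - quasihyperbolic X z (γ L)) / 2)
    linarith

end
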